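/- Let D : E → F be a Fréchet-differentiable map between Banach spaces... Concretely: let (A_λ)_{λ ∈ ℂ} be a family of bounded operators on a Hilbert space H such that λ ↦ A_λ is analytic (entire), each A_λ is compact, and Id + A_{λ₀} is injective for some λ₀ ∈ ℂ. Then the set {λ ∈ ℂ : Id + A_λ is not injective} is discrete (has no accumulation point in ℂ). -/

import Mathlib

open Filter Topology

/-- A compact operator with values in a Hilbert space is within any `ε > 0` of its composition with
the orthogonal projection onto some finite-dimensional subspace. -/
lemma IsCompactOperator.exists_finiteDimensional_norm_sub_starProjection_comp_lt
    {𝕜 E H : Type*} [RCLike 𝕜] [NormedAddCommGroup E] [NormedSpace 𝕜 E]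
    [NormedAddCommGroup H] [InnerProductSpace 𝕜 H] {T : E →L[𝕜] H} (hT : IsCompactOperator T)
    {ε : ℝ} (hε : 0 < ε) :
    ∃ (V : Submodule 𝕜 H) (_ : FiniteDimensional 𝕜 V), ‖T - V.starProjection ∘L T‖ < ε := by
  have hTB : TotallyBounded (T '' Metric.closedBall 0 1) :=
    (hT.isCompact_closure_image_closedBall 1).totallyBounded.subset subset_closure
  obtain ⟨t, ht, hcover⟩ := Metric.totallyBounded_iff.1 hTB (ε / 2) (half_pos hε)
  have hV : FiniteDimensional 𝕜 (Submodule.span 𝕜 t) := FiniteDimensional.span_of_finite 𝕜 ht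
  refine ⟨Submodule.span 𝕜 t, hV, lt_of_le_of_lt ?_ (half_lt_self hε)⟩
  refine ContinuousLinearMap.opNorm_le_of_unit_norm (half_pos hε).le fun x hx => ?_
  obtain ⟨y, hyt, hy⟩ := Set.mem_iUnion₂.1
    (hcover (Set.mem_image_of_mem T (mem_closedBall_zero_iff.2 hx.le)))
  have hmin := Submodule.starProjection_minimal (U := Submodule.span 𝕜 t) (T x)
  have hle : ‖T x - (Submodule.span 𝕜 t).starProjection (T x)‖ ≤ ‖T x - y‖ := by
    rw [hmin]
    exact ciInf_le ⟨0, Set.forall_mem_range.2 fun _ => norm_nonneg _⟩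
      (⟨y, Submodule.subset_span hyt⟩ : Submodule.span 𝕜 t)
  rw [Metric.mem_ball, dist_eq_norm] at hy
  simpa using hle.trans hy.le

/-- The determinant of an analytic family of endomorphisms of a finite-dimensional space is
analytic. -/
lemma AnalyticAt.linearMap_det {𝕜 E V : Type*} [NontriviallyNormedField 𝕜] [CompleteSpace 𝕜]
    [NormedAddCommGroup E] [NormedSpace 𝕜 E] [NormedAddCommGroup V] [NormedSpace 𝕜 V]
    [FiniteDimensional 𝕜 V] {φ : E → V →L[𝕜] V} {z : E} (hφ : AnalyticAt 𝕜 φ z) :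
    AnalyticAt 𝕜 (fun w => LinearMap.det (φ w : V →ₗ[𝕜] V)) z := by
  let b := Module.finBasis 𝕜 V
  simp only [← LinearMap.det_toMatrix b, Matrix.det_apply, LinearMap.toMatrix_apply,
    Units.smul_def, zsmul_eq_mul]
  refine Finset.analyticAt_fun_sum _ fun σ _ => analyticAt_const.mul <|
    Finset.analyticAt_fun_prod _ fun i _ => ?_
  exact ((LinearMap.toContinuousLinearMap (b.coord (σ i))) ∘L
    ContinuousLinearMap.apply 𝕜 V (b i)).analyticAt _ |>.comp hφ

/-- Reduction of injectivity of `B + L ∘ G`, with `B` invertible, to the space through which the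
perturbation `L ∘ G` factors. -/
lemma ContinuousLinearMap.injective_add_comp_iff {𝕜 E V : Type*} [NontriviallyNormedField 𝕜]
    [NormedAddCommGroup E] [NormedSpace 𝕜 E] [NormedAddCommGroup V] [NormedSpace 𝕜 V]
    {B : E →L[𝕜] E} (hB : IsUnit B) (L : V →L[𝕜] E) (G : E →L[𝕜] V) :
    Function.Injective (B + L ∘L G) ↔
      Function.Injective (ContinuousLinearMap.id 𝕜 V + G ∘L Ring.inverse B ∘L L) := by
  have hl (x : E) : Ring.inverse B (B x) = x :=
    DFunLike.congr_fun (Ring.inverse_mul_cancel B hB) x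
  have hr (x : E) : B (Ring.inverse B x) = x :=
    DFunLike.congr_fun (Ring.mul_inverse_cancel B hB) x
  simp only [injective_iff_map_eq_zero, add_apply, comp_apply, id_apply]
  constructor
  · intro h v hv
    have hx : Ring.inverse B (L v) = 0 := h _ (by rw [hr, ← map_add, hv, map_zero])
    simpa [hx] using hv
  · intro h x hx
    have hx' : x = -Ring.inverse B (L (G x)) := by
      rw [← map_neg, ← eq_neg_of_add_eq_zero_left hx, hl]
    have hG : G x = 0 := h _ (by
      conv_lhs => enter [1]; rw [hx']
      simp)
    simpa [hG] using hx'

/-- Local form of the analytic Fredholm theorem: near `z`, the operators `Id + A w` fail to be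
injective exactly at the zeros of a function analytic at `z`. -/
lemma AnalyticAt.exists_injective_id_add_iff_ne_zero {H : Type*} [NormedAddCommGroup H]
    [InnerProductSpace ℂ H] [CompleteSpace H] {A : ℂ → H →L[ℂ] H} {z : ℂ}
    (hA : AnalyticAt ℂ A z) (hc : IsCompactOperator (A z)) :
    ∃ f : ℂ → ℂ, AnalyticAt ℂ f z ∧
      ∀ᶠ w in 𝓝 z, Function.Injective (ContinuousLinearMap.id ℂ H + A w) ↔ f w ≠ 0 := by
  obtain ⟨V, _, hV⟩ :=
    hc.exists_finiteDimensional_norm_sub_starProjection_comp_lt one_pos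
  let G : H →L[ℂ] V := V.orthogonalProjectionOnto ∘L A z
  let B : ℂ → H →L[ℂ] H := fun w => 1 + A w - V.subtypeL ∘L G
  have hBan : AnalyticAt ℂ B z := (analyticAt_const.add hA).sub analyticAt_const
  have hBz : IsUnit (B z) := by
    have hnorm : ‖-(A z - V.subtypeL ∘L G)‖ < 1 := by rw [norm_neg]; exact hV
    have h := isUnit_one_sub_of_norm_lt_one hnorm
    rwa [sub_neg_eq_add, ← add_sub_assoc] at h
  have hinv : AnalyticAt ℂ (fun w => Ring.inverse (B w)) z := by
    obtain ⟨u, hu⟩ := hBz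
    have h : AnalyticAt ℂ Ring.inverse (B z) := hu ▸ analyticAt_inverse u
    exact h.comp hBan
  have hφ : AnalyticAt ℂ
      (fun w => ContinuousLinearMap.id ℂ V + G ∘L Ring.inverse (B w) ∘L V.subtypeL) z :=
    analyticAt_const.add <|
      ((ContinuousLinearMap.compL ℂ V H V G) ∘L
        ((ContinuousLinearMap.compL ℂ V H H).flip V.subtypeL)).analyticAt _ |>.comp hinv
  refine ⟨_, hφ.linearMap_det, ?_⟩
  filter_upwards [hBan.continuousAt.eventually (Units.isOpen.mem_nhds hBz)] with w hw
  have hsplit : ContinuousLinearMap.id ℂ H + A w = B w + V.subtypeL ∘L G :=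
    (sub_add_cancel _ _).symm
  rw [hsplit, ContinuousLinearMap.injective_add_comp_iff hw, ← isUnit_iff_ne_zero,
    ← LinearMap.isUnit_iff_isUnit_det, LinearMap.isUnit_iff_ker_eq_bot, LinearMap.ker_eq_bot]
  rfl

/-- Analytic Fredholm theorem consequence: for an entire family of compact operators
`A_λ`, if `Id + A_{λ₀}` is injective for some `λ₀`, the set of `λ` where `Id + A_λ`
fails to be injective has no accumulation point in `ℂ`. -/
theorem stmt14 (H : Type*) [NormedAddCommGroup H] [InnerProductSpace ℂ H]
    [CompleteSpace H]
    (A : ℂ → (H →L[ℂ] H))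
    (hanalytic : ∀ z : ℂ, AnalyticAt ℂ A z)
    (hcompact : ∀ z : ℂ, IsCompactOperator (A z))
    (lam₀ : ℂ)
    (hinj : Function.Injective ⇑(ContinuousLinearMap.id ℂ H + A lam₀)) :
    ∀ z : ℂ, ¬ AccPt z (Filter.principal
      {lam : ℂ | ¬ Function.Injective ⇑(ContinuousLinearMap.id ℂ H + A lam)}) := by
  have hdich (z : ℂ) :
      (∀ᶠ w in 𝓝 z, ¬ Function.Injective (ContinuousLinearMap.id ℂ H + A w)) ∨
        ∀ᶠ w in 𝓝[≠] z, Function.Injective (ContinuousLinearMap.id ℂ H + A w) := by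
    obtain ⟨f, hf, hiff⟩ := (hanalytic z).exists_injective_id_add_iff_ne_zero (hcompact z)
    refine hf.eventually_eq_zero_or_eventually_ne_zero.imp (fun h => ?_) fun h => ?_
    · filter_upwards [h, hiff] with w hw hw' using fun hi => hw'.1 hi hw
    · filter_upwards [h, hiff.filter_mono nhdsWithin_le_nhds] with w hw hw' using hw'.2 hw
  let S : Set ℂ := {z | ∀ᶠ w in 𝓝 z, ¬ Function.Injective (ContinuousLinearMap.id ℂ H + A w)}
  have hSopen : IsOpen S := isOpen_setOfPred_eventually_nhds
  have hSclosed : IsClosed S := by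
    refine isOpen_compl_iff.1 (isOpen_iff_mem_nhds.2 fun z hz => ?_)
    filter_upwards [eventually_nhdsWithin_iff.1 ((hdich z).resolve_left hz)] with w hw hwS
    by_cases hwz : w = z
    · exact hz (hwz ▸ hwS)
    · exact hwS.self_of_nhds (hw hwz)
  have hSempty : S = ∅ := (isClopen_iff.1 ⟨hSclosed, hSopen⟩).resolve_right fun h =>
    (h ▸ Set.mem_univ lam₀ : lam₀ ∈ S).self_of_nhds hinj
  intro z hz
  refine accPt_iff_frequently_nhdsNE.1 hz ?_
  filter_upwards [(hdich z).resolve_left (Set.eq_empty_iff_forall_notMem.1 hSempty z)] with w hw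
  exact not_not.2 hw
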